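/- Let δ be a real number with 0 < δ < 1/3 and H(3δ/2) < 1/2. Then there exists a sequence of odd positive integers m_1 < m_2 < ⋯ with m_i → ∞ and, for each i, polynomials a_i(X), b_i(X) ∈ J_{m_i}, such that the codes C_i = C_{a_i, b_i} satisfy: (i) the rate R(C_i) = dim C_i / (3 m_i) tends to 1/3 as i → ∞; and (ii) the relative minimum distance Δ(C_i) > δ for all i (i.e., every nonzero codeword (f, 2g) of C_i has wt_H(f) + 2·wt_H(g) > 3 m_i δ). In particular, Z2Z4-additive cyclic codes are asymptotically good. -/

import Mathlib

open Polynomial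

noncomputable section

/-- The polynomial `X^m - 1` over `Z/2`. -/
def fm (m : ℕ) : Polynomial (ZMod 2) := X ^ m - 1

/-- The polynomial `X^m - 1` over `Z/4`. -/
def fm4 (m : ℕ) : Polynomial (ZMod 4) := X ^ m - 1

/-- `R_m = (Z/2)[X]/⟨X^m - 1⟩`. -/
abbrev R2 (m : ℕ) : Type := Polynomial (ZMod 2) ⧸ Ideal.span {fm m}

/-- `R'_m = (Z/4)[X]/⟨X^m - 1⟩`. -/
abbrev R4 (m : ℕ) : Type := Polynomial (ZMod 4) ⧸ Ideal.span {fm4 m}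

def mk2 (m : ℕ) : Polynomial (ZMod 2) →+* R2 m := Ideal.Quotient.mk _

def mk4 (m : ℕ) : Polynomial (ZMod 4) →+* R4 m := Ideal.Quotient.mk _

/-- The canonical representative (of degree `< m`) of an element of `R2 m`. -/
def rep2 (m : ℕ) (r : R2 m) : Polynomial (ZMod 2) :=
  (Function.surjInv (Ideal.Quotient.mk_surjective (I := Ideal.span {fm m})) r) %ₘ fm m

/-- The canonical representative (of degree `< m`) of an element of `R4 m`. -/
def rep4 (m : ℕ) (r : R4 m) : Polynomial (ZMod 4) :=
  (Function.surjInv (Ideal.Quotient.mk_surjective (I := Ideal.span {fm4 m})) r) %ₘ fm4 m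

/-- Coefficientwise doubling map `(Z/2)[X] → (Z/4)[X]`, `a ↦ 2a` on each coefficient. -/
def polyDbl (p : Polynomial (ZMod 2)) : Polynomial (ZMod 4) :=
  ∑ i ∈ p.support, Polynomial.C (2 * ((p.coeff i).val : ZMod 4)) * X ^ i

/-- The additive embedding `R_m → R'_m`, `f ↦ 2f`. -/
def iota (m : ℕ) (r : R2 m) : R4 m := mk4 m (polyDbl (rep2 m r))

/-- Hamming weight of an element of `R_m` (of its coefficient vector). -/
def wt2 (m : ℕ) (r : R2 m) : ℕ := (rep2 m r).support.card

/-- Lee weight of an element of `Z/4`. -/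
def lee (x : ZMod 4) : ℕ := min x.val (4 - x.val)

/-- Lee weight of an element of `R'_m` (of its coefficient vector). -/
def wtLee (m : ℕ) (r : R4 m) : ℕ := ∑ i ∈ (rep4 m r).support, lee ((rep4 m r).coeff i)

/-- The augmentation ideal `J_m = ⟨X - 1⟩` of `R_m`. -/
def Jm (m : ℕ) : Ideal (R2 m) := Ideal.span {mk2 m (X - 1)}

/-- The `Z2Z4`-additive cyclic code `C_{a,b} = {(f·a, 2(f·b)) : f ∈ R_m}`. -/
def Cab (m : ℕ) (a b : R2 m) : Set (R2 m × R4 m) :=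
  {w | ∃ f : R2 m, w = (f * a, iota m (f * b))}

/-- Dimension of `C_{a,b}` as a vector space over `Z/2`, i.e. `log₂ |C_{a,b}|`. -/
def dimCab (m : ℕ) (a b : R2 m) : ℕ := Nat.log 2 (Nat.card (Cab m a b))

/-- `(X^m - 1)/(X - 1) = X^{m-1} + ⋯ + X + 1` over `Z/2`. -/
def geomPoly (m : ℕ) : Polynomial (ZMod 2) := ∑ i ∈ Finset.range m, X ^ i

/-- `ℓ_m`: minimal degree of the irreducible factors of `(X^m-1)/(X-1)` in `(Z/2)[X]`. -/
def ell (m : ℕ) : ℕ :=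
  sInf {d | ∃ p : Polynomial (ZMod 2), Irreducible p ∧ p ∣ geomPoly m ∧ p.natDegree = d}

/-- The binary entropy function `H(x) = -x·log₂x - (1-x)·log₂(1-x)`. -/
def Hent (x : ℝ) : ℝ := -(x * Real.logb 2 x) - (1 - x) * Real.logb 2 (1 - x)

/-- A prime whose order of two is at least its fourth root. -/
def GoodP (q : ℕ) : Prop := q.Prime ∧ ∀ k, 0 < k → q ∣ 2 ^ k - 1 → q < k ^ 4

lemma card_pf (k : ℕ) (hk : 0 < k) : (2 ^ k - 1).primeFactors.card ≤ k := by
  have h1 : 1 < 2 ^ k := Nat.one_lt_two_pow (by omega)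
  have h0 : 2 ^ k - 1 ≠ 0 := by omega
  have h2 : 2 ^ (2 ^ k - 1).primeFactors.card ≤ ∏ p ∈ (2 ^ k - 1).primeFactors, p := by
    rw [← Finset.prod_const]
    exact Finset.prod_le_prod' (fun p hp => (Nat.prime_of_mem_primeFactors hp).two_le)
  have h3 := Nat.le_of_dvd (Nat.pos_of_ne_zero h0) (Nat.prod_primeFactors_dvd (2 ^ k - 1))
  have h4 : 2 ^ (2 ^ k - 1).primeFactors.card < 2 ^ k := by omega
  exact ((Nat.pow_lt_pow_iff_right (by norm_num)).1 h4).le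

lemma good_infinite : {q | GoodP q}.Infinite := by
  intro hfin
  apply not_summable_one_div_on_primes
  classical
  let B : Set ℕ := {q | q.Prime ∧ ¬ GoodP q}
  have hB : ∀ q : ℕ, ∃ k, q ∈ B → 0 < k ∧ q ∣ 2 ^ k - 1 ∧ k ^ 4 ≤ q := by
    intro q
    by_cases hq : q ∈ B
    · obtain ⟨h1, h2⟩ := hq
      have : ∃ k, 0 < k ∧ q ∣ 2 ^ k - 1 ∧ k ^ 4 ≤ q := by
        by_contra! h
        exact h2 ⟨h1, fun k hk hd => h k hk hd⟩
      obtain ⟨k, hk⟩ := this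
      exact ⟨k, fun _ => hk⟩
    · exact ⟨0, fun h => absurd h hq⟩
  choose kk hkk using hB
  have hs3 : Summable (fun k : ℕ => 1 / (k : ℝ) ^ 3) := by
    exact (Real.summable_one_div_nat_pow (p := 3)).2 (by norm_num)
  have hsB : Summable (B.indicator (fun n : ℕ => (1 / n : ℝ))) := by
    refine summable_of_sum_le (c := ∑' k : ℕ, 1 / (k : ℝ) ^ 3)
      (fun n => Set.indicator_nonneg (fun _ _ => by positivity) n) ?_
    intro s
    set s' := s.filter (fun i => i ∈ B) with hs'
    have hss : ∑ q ∈ s, B.indicator (fun n : ℕ => (1 / n : ℝ)) q = ∑ q ∈ s', (1 / q : ℝ) := by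
      rw [hs', Finset.sum_filter]
      exact Finset.sum_congr rfl (fun q _ => by rw [Set.indicator_apply])
    rw [hss]
    rw [← Finset.sum_fiberwise_of_maps_to (s := s') (t := s'.image kk) (g := kk)
      (fun x hx => Finset.mem_image_of_mem _ hx)]
    refine le_trans (Finset.sum_le_sum ?_) (hs3.sum_le_tsum (s'.image kk) (fun _ _ => by positivity))
    intro k hk
    obtain ⟨q0, hq0, rfl⟩ := Finset.mem_image.1 hk
    have hq0B : q0 ∈ B := (Finset.mem_filter.1 hq0).2
    have hkpos := (hkk q0 hq0B).1
    set k := kk q0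
    have hcard : (s'.filter (fun q => kk q = k)).card ≤ k := by
      refine le_trans (Finset.card_le_card ?_) (card_pf k hkpos)
      intro q hq
      rw [Finset.mem_filter] at hq
      have hqB : q ∈ B := (Finset.mem_filter.1 hq.1).2
      have := hkk q hqB
      rw [hq.2] at this
      rw [Nat.mem_primeFactors]
      have h1 : 1 < 2 ^ k := Nat.one_lt_two_pow (by omega)
      exact ⟨hqB.1, this.2.1, by omega⟩
    have hkR : (0:ℝ) < k := by exact_mod_cast hkpos
    calc _ ≤ ∑ q ∈ s'.filter (fun q => kk q = k), 1 / (k : ℝ) ^ 4 := by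
            refine Finset.sum_le_sum ?_
            intro q hq
            rw [Finset.mem_filter] at hq
            have hqB : q ∈ B := (Finset.mem_filter.1 hq.1).2
            have := hkk q hqB
            rw [hq.2] at this
            have h4 : (k : ℝ) ^ 4 ≤ q := by exact_mod_cast this.2.2
            exact one_div_le_one_div_of_le (by positivity) h4
      _ = (s'.filter (fun q => kk q = k)).card * (1 / (k : ℝ) ^ 4) := by simp
      _ ≤ k * (1 / (k : ℝ) ^ 4) := by
            gcongr
      _ = 1 / (k : ℝ) ^ 3 := by field_simp
  have hsG : Summable ({q | GoodP q}.indicator (fun n : ℕ => (1 / n : ℝ))) := by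
    apply summable_of_hasFiniteSupport
    exact hfin.subset Set.support_indicator_subset
  refine (hsB.add hsG).congr ?_
  intro q
  by_cases h1 : q.Prime <;> by_cases h2 : GoodP q
  · simp [Set.indicator, B, h1, h2]
  · simp [Set.indicator, B, h1, h2]
  · exact absurd h2.1 h1
  · simp [Set.indicator, B, h1, h2]

lemma geom_mul (m : ℕ) : geomPoly m * (X - 1) = fm m := by
  simpa [geomPoly, fm] using geom_sum_mul (X : Polynomial (ZMod 2)) m

lemma geom_eval (m : ℕ) : (geomPoly m).eval 1 = (m : ZMod 2) := by
  simp [geomPoly, eval_finsetSum]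

lemma irr_deg (q : ℕ) (hq : GoodP q) (hodd : Odd q) (p : Polynomial (ZMod 2)) (hp : Irreducible p)
    (hd : p ∣ geomPoly q) : q < p.natDegree ^ 4 := by
  have : Fact (Irreducible p) := ⟨hp⟩
  have hp0 : p ≠ 0 := hp.ne_zero
  have hdeg : 0 < p.natDegree := hp.natDegree_pos
  have : Module.Finite (ZMod 2) (AdjoinRoot p) := PowerBasis.finite (AdjoinRoot.powerBasis hp0)
  have : Finite (AdjoinRoot p) := Module.finite_of_finite (ZMod 2)
  have := Fintype.ofFinite (AdjoinRoot p)
  have hcard : Fintype.card (AdjoinRoot p) = 2 ^ p.natDegree := by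
    rw [Module.card_eq_pow_finrank (K := ZMod 2), ZMod.card]
    congr 1
    exact finrank_quotient_span_eq_natDegree
  set α := AdjoinRoot.root p
  have hg : aeval α (geomPoly q) = 0 := by
    obtain ⟨r, hr⟩ := hd
    rw [hr, map_mul]
    simp [α]
  have hα1 : α ^ q = 1 := by
    have : aeval α (fm q) = 0 := by rw [← geom_mul, map_mul, hg, zero_mul]
    simp [fm] at this
    exact sub_eq_zero.1 this
  have hαne : α ≠ 1 := by
    intro h
    rw [h] at hg
    have h1 : aeval (1 : AdjoinRoot p) (geomPoly q) = (q : AdjoinRoot p) := by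
      simp [geomPoly]
    rw [h1] at hg
    have h2 : ((q : ZMod 2)) = 0 := by
      apply (algebraMap (ZMod 2) (AdjoinRoot p)).injective
      simpa using hg
    rw [ZMod.natCast_eq_zero_iff] at h2
    exact (Nat.not_even_iff_odd.2 hodd) (even_iff_two_dvd.2 h2)
  have : Fact q.Prime := ⟨hq.1⟩
  have hord : orderOf α = q := orderOf_eq_prime hα1 hαne
  have hα0 : α ≠ 0 := by
    intro h
    rw [h, zero_pow hq.1.ne_zero] at hα1
    exact zero_ne_one hα1
  have hd : q ∣ 2 ^ p.natDegree - 1 := by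
    rw [← hord, ← hcard]
    exact orderOf_dvd_of_pow_eq_one (FiniteField.pow_card_sub_one_eq_one α hα0)
  exact hq.2 _ hdeg hd

lemma fm_monic (m : ℕ) [NeZero m] : (fm m).Monic := by
  simpa [fm] using monic_X_pow_sub_C (1 : ZMod 2) (NeZero.ne m)

lemma fm_natDegree (m : ℕ) : (fm m).natDegree = m := by
  simpa [fm] using natDegree_X_pow_sub_C (n := m) (r := (1 : ZMod 2))

lemma fm_degree (m : ℕ) [NeZero m] : (fm m).degree = m := by
  rw [degree_eq_natDegree (fm_monic m).ne_zero, fm_natDegree]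

lemma mk2_eq_iff (m : ℕ) (p q : Polynomial (ZMod 2)) : mk2 m p = mk2 m q ↔ fm m ∣ p - q := by
  rw [mk2, Ideal.Quotient.eq, Ideal.mem_span_singleton]

lemma mk2_mod (m : ℕ) (p : Polynomial (ZMod 2)) : mk2 m (p %ₘ fm m) = mk2 m p := by
  rw [mk2_eq_iff, modByMonic_eq_sub_mul_div]
  refine ⟨-(p /ₘ fm m), by ring⟩

lemma mk2_rep2 (m : ℕ) (r : R2 m) : mk2 m (rep2 m r) = r := by
  rw [rep2, mk2_mod]
  exact Function.surjInv_eq (Ideal.Quotient.mk_surjective (I := Ideal.span {fm m})) r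

lemma mk2_surj (m : ℕ) : Function.Surjective (mk2 m) := fun r => ⟨rep2 m r, mk2_rep2 m r⟩

lemma rep2_degree (m : ℕ) [NeZero m] (r : R2 m) : (rep2 m r).degree < m := by
  rw [rep2, ← fm_degree]
  exact degree_modByMonic_lt _ (fm_monic m)

lemma rep2_unique (m : ℕ) [NeZero m] (r : R2 m) (p : Polynomial (ZMod 2)) (hp : p.degree < m)
    (h : mk2 m p = r) : rep2 m r = p := by
  have h1 : fm m ∣ rep2 m r - p := by rw [← mk2_eq_iff, mk2_rep2, h]
  have h2 : (rep2 m r - p).degree < (fm m).degree := by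
    rw [fm_degree]
    exact lt_of_le_of_lt (degree_sub_le _ _) (max_lt (rep2_degree m r) hp)
  exact sub_eq_zero.1 (eq_zero_of_dvd_of_degree_lt h1 h2)

lemma rep2_zero (m : ℕ) [NeZero m] : rep2 m 0 = 0 :=
  rep2_unique m 0 0 (by simp [degree_zero]) (map_zero _)

lemma iota_zero (m : ℕ) [NeZero m] : iota m 0 = 0 := by
  simp [iota, rep2_zero, polyDbl]

/-- Coordinates indexed by `ZMod m`. -/
def crd (m : ℕ) (u : R2 m) (j : ZMod m) : ZMod 2 := (rep2 m u).coeff j.val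

lemma crd_shift (m : ℕ) [NeZero m] (hm : 1 < m) (u : R2 m) (j : ZMod m) :
    crd m (mk2 m X * u) (j + 1) = crd m u j := by
  set p := rep2 m u with hp
  have hpd : p.degree < m := rep2_degree m u
  have hpd' : ∀ k, m ≤ k → p.coeff k = 0 := fun k hk =>
    coeff_eq_zero_of_degree_lt (lt_of_lt_of_le hpd (by exact_mod_cast hk))
  have hfc : ∀ k, (fm m).coeff k = (if k = m then 1 else 0) - (if k = 0 then 1 else 0) := by
    intro k
    rw [fm, coeff_sub, coeff_X_pow, coeff_one]
  have hrep : rep2 m (mk2 m X * u) = X * p - C (p.coeff (m - 1)) * fm m := by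
    apply rep2_unique
    · rw [degree_lt_iff_coeff_zero]
      intro k hk
      obtain ⟨k, rfl⟩ : ∃ k', k = k' + 1 := ⟨k - 1, by omega⟩
      rw [coeff_sub, coeff_X_mul, coeff_C_mul, hfc]
      by_cases h : k + 1 = m
      · have : k = m - 1 := by omega
        simp [this, show m - 1 + 1 = m by omega, NeZero.ne m]
      · rw [hpd' k (by omega)]
        simp [h]
    · rw [map_sub, map_mul, map_mul, mk2_rep2]
      have : mk2 m (fm m) = 0 := by
        rw [← map_zero (mk2 m), mk2_eq_iff]; simp
      rw [this]; simp
  unfold crd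
  rw [hrep]
  have : Fact (1 < m) := ⟨hm⟩
  have hj : (j + 1).val = (j.val + 1) % m := by
    rw [ZMod.val_add, ZMod.val_one]
  have hjl := ZMod.val_lt j
  rw [hj]
  by_cases h : j.val + 1 < m
  · rw [Nat.mod_eq_of_lt h, coeff_sub, coeff_X_mul, coeff_C_mul, hfc]
    simp [h.ne]; rfl
  · have h' : j.val + 1 = m := by omega
    have h'' : j.val = m - 1 := by omega
    rw [h', Nat.mod_self, coeff_sub, coeff_C_mul, hfc, h'']
    simp [(NeZero.ne m).symm]; rfl

lemma crd_shift_pow (m : ℕ) [NeZero m] (hm : 1 < m) (u : R2 m) (i : ℕ) (j : ZMod m) :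
    crd m (mk2 m X ^ i * u) j = crd m u (j - i) := by
  induction i generalizing j with
  | zero => simp
  | succ i ih =>
    have h := crd_shift m hm (mk2 m X ^ i * u) (j - 1)
    rw [sub_add_cancel, ih] at h
    rw [pow_succ', mul_assoc, h]
    congr 1
    push_cast; ring

lemma mk2_X_pow (m : ℕ) : mk2 m X ^ m = 1 := by
  rw [← map_pow, ← map_one (mk2 m), mk2_eq_iff]
  simp [fm]

lemma shift_inj (m : ℕ) [NeZero m] (i : ℕ) : Function.Injective (fun u : R2 m => mk2 m X ^ i * u) := by
  have h : IsUnit (mk2 m X) := IsUnit.of_mul_eq_one (mk2 m X ^ (m - 1)) (by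
    rw [← pow_succ', Nat.sub_add_cancel (NeZero.one_le), mk2_X_pow])
  exact (h.pow i).mul_right_injective

lemma wt2_eq (m : ℕ) [NeZero m] (u : R2 m) :
    wt2 m u = (Finset.univ.filter (fun j => crd m u j ≠ 0)).card := by
  unfold wt2
  symm
  refine Finset.card_bij (fun j _ => j.val) ?_ ?_ ?_
  · intro j hj
    exact mem_support_iff.2 (Finset.mem_filter.1 hj).2
  · intro a _ b _ h
    exact ZMod.val_injective m h
  · intro k hk
    have hk' : k < m := by
      by_contra h
      rw [mem_support_iff] at hk
      exact hk (coeff_eq_zero_of_degree_lt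
        (lt_of_lt_of_le (rep2_degree m u) (by exact_mod_cast not_lt.1 h)))
    refine ⟨(k : ZMod m), ?_, ZMod.val_cast_of_lt hk'⟩
    refine Finset.mem_filter.2 ⟨Finset.mem_univ _, ?_⟩
    rw [crd, ZMod.val_cast_of_lt hk']
    exact mem_support_iff.1 hk

instance r2_modfin (m : ℕ) [NeZero m] : Module.Finite (ZMod 2) (R2 m) :=
  PowerBasis.finite (AdjoinRoot.powerBasis (f := fm m) (fm_monic m).ne_zero)

instance r2_finite (m : ℕ) [NeZero m] : Finite (R2 m) := Module.finite_of_finite (ZMod 2)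

instance r2_fintype (m : ℕ) [NeZero m] : Fintype (R2 m) := Fintype.ofFinite _

instance r2_ideal_finite (m : ℕ) [NeZero m] : Finite (Ideal (R2 m)) :=
  Finite.of_injective (fun I : Ideal (R2 m) => (I : Set (R2 m))) SetLike.coe_injective

instance r2_ideal_fintype (m : ℕ) [NeZero m] : Fintype (Ideal (R2 m)) := Fintype.ofFinite _

lemma card_quot (g : Polynomial (ZMod 2)) (hg : g ≠ 0) :
    Nat.card (Polynomial (ZMod 2) ⧸ Ideal.span {g}) = 2 ^ g.natDegree := by
  have : Module.Finite (ZMod 2) (Polynomial (ZMod 2) ⧸ Ideal.span {g}) :=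
    PowerBasis.finite (AdjoinRoot.powerBasis (f := g) hg)
  rw [Module.natCard_eq_pow_finrank (K := ZMod 2), Nat.card_zmod,
    finrank_quotient_span_eq_natDegree]

lemma ideal_struct (m : ℕ) [NeZero m] (I : Ideal (R2 m)) :
    ∃ g h : Polynomial (ZMod 2), g * h = fm m ∧ (∀ p, mk2 m p ∈ I ↔ g ∣ p) ∧
      Nat.card I = 2 ^ h.natDegree := by
  obtain ⟨g, hg⟩ := (IsPrincipalIdealRing.principal (I.comap (mk2 m))).principal
  have hmem : ∀ p, mk2 m p ∈ I ↔ g ∣ p := by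
    intro p
    rw [← Ideal.mem_comap, hg]
    exact Ideal.mem_span_singleton
  have hf0 : mk2 m (fm m) = 0 := by rw [← map_zero (mk2 m), mk2_eq_iff]; simp
  have hgd : g ∣ fm m := by rw [← hmem, hf0]; exact I.zero_mem
  obtain ⟨h, hh⟩ := hgd
  refine ⟨g, h, hh.symm, hmem, ?_⟩
  have hfne := (fm_monic m).ne_zero
  have hg0 : g ≠ 0 := by rintro rfl; exact hfne (by rw [hh, zero_mul])
  have hh0 : h ≠ 0 := by rintro rfl; exact hfne (by rw [hh, mul_zero])
  have hdeg : m = g.natDegree + h.natDegree := by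
    rw [← natDegree_mul hg0 hh0, ← hh, fm_natDegree]
  have h1 : Nat.card (R2 m) = Nat.card I * Nat.card (R2 m ⧸ I) :=
    Submodule.card_eq_card_quotient_mul_card I
  have h2 : Nat.card (R2 m) = 2 ^ m := by rw [card_quot _ hfne, fm_natDegree]
  let φ : Polynomial (ZMod 2) →+* R2 m ⧸ I := (Ideal.Quotient.mk I).comp (mk2 m)
  have hφ : Function.Surjective φ := Ideal.Quotient.mk_surjective.comp (mk2_surj m)
  have hker : RingHom.ker φ = Ideal.span {g} := by
    ext p
    rw [RingHom.mem_ker, Ideal.mem_span_singleton, ← hmem]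
    exact Ideal.Quotient.eq_zero_iff_mem
  have h3 : Nat.card (R2 m ⧸ I) = 2 ^ g.natDegree := by
    rw [← card_quot g hg0, ← hker]
    exact (Nat.card_congr (RingHom.quotientKerEquivOfSurjective hφ).toEquiv).symm
  rw [h2, h3] at h1
  have h4 : 2 ^ m = 2 ^ h.natDegree * 2 ^ g.natDegree := by rw [← pow_add, add_comm, ← hdeg]
  rw [h4] at h1
  exact (Nat.eq_of_mul_eq_mul_right (by positivity) h1).symm

/-- Dimension of an ideal. -/
def dI (m : ℕ) (I : Ideal (R2 m)) : ℕ := Nat.log 2 (Nat.card I)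

lemma card_dI (m : ℕ) [NeZero m] (I : Ideal (R2 m)) : Nat.card I = 2 ^ dI m I := by
  obtain ⟨g, h, _, _, hc⟩ := ideal_struct m I
  rw [dI, hc, Nat.log_pow (by norm_num)]

lemma ideal_struct' (m : ℕ) [NeZero m] (I : Ideal (R2 m)) :
    ∃ g h : Polynomial (ZMod 2), g * h = fm m ∧ (∀ p, mk2 m p ∈ I ↔ g ∣ p) ∧
      dI m I = h.natDegree := by
  obtain ⟨g, h, h1, h2, hc⟩ := ideal_struct m I
  refine ⟨g, h, h1, h2, ?_⟩
  rw [dI, hc, Nat.log_pow (by norm_num)]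

/-- The last `d` coordinates. -/
def topS (m d : ℕ) [NeZero m] : Finset (ZMod m) := Finset.univ.filter (fun j => m - d ≤ j.val)

lemma topS_card (m d : ℕ) [NeZero m] (hd : d ≤ m) : (topS m d).card = d := by
  have : (topS m d).card = (Finset.Ico (m - d) m).card := by
    refine Finset.card_bij (fun j _ => j.val) ?_ ?_ ?_
    · intro j hj
      simp only [topS, Finset.mem_filter] at hj
      simp [hj.2, ZMod.val_lt j]
    · intro a _ b _ h
      exact ZMod.val_injective m h
    · intro k hk
      rw [Finset.mem_Ico] at hk
      refine ⟨(k : ZMod m), ?_, ZMod.val_cast_of_lt hk.2⟩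
      simp [topS, ZMod.val_cast_of_lt hk.2]
      omega
  rw [this, Nat.card_Ico]; omega

/-- Support inside a set of coordinates. -/
def suppS (m : ℕ) (S : Finset (ZMod m)) (u : R2 m) : Finset (ZMod m) :=
  S.filter (fun j => crd m u j ≠ 0)

lemma zmod2_eq {a b : ZMod 2} (h : a ≠ 0 ↔ b ≠ 0) : a = b := by
  revert h; revert a b; decide

lemma dI_le (m : ℕ) [NeZero m] (I : Ideal (R2 m)) : dI m I ≤ m := by
  obtain ⟨g, h, h1, h2, hc⟩ := ideal_struct' m I
  rw [hc]
  have := natDegree_le_of_dvd (Dvd.intro_left g h1) (fm_monic m).ne_zero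
  rwa [fm_natDegree] at this

lemma supp_inj (m : ℕ) [NeZero m] (I : Ideal (R2 m)) :
    Set.InjOn (suppS m (topS m (dI m I))) (I : Set (R2 m)) := by
  obtain ⟨g, h, h1, h2, hc⟩ := ideal_struct' m I
  have hfne := (fm_monic m).ne_zero
  have hg0 : g ≠ 0 := by rintro rfl; exact hfne (by rw [← h1, zero_mul])
  have hh0 : h ≠ 0 := by rintro rfl; exact hfne (by rw [← h1, mul_zero])
  have hdeg : m = g.natDegree + h.natDegree := by
    rw [← natDegree_mul hg0 hh0, h1, fm_natDegree]
  intro u hu v hv huv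
  have hgu : g ∣ rep2 m u := by rw [← h2, mk2_rep2]; exact hu
  have hgv : g ∣ rep2 m v := by rw [← h2, mk2_rep2]; exact hv
  have hsub : rep2 m u - rep2 m v = 0 := by
    apply eq_zero_of_dvd_of_degree_lt (dvd_sub hgu hgv)
    rw [degree_eq_natDegree hg0, degree_lt_iff_coeff_zero]
    intro k hk
    rw [coeff_sub, sub_eq_zero]
    by_cases hkm : k < m
    · have hmem : ∀ w : R2 m, (k : ZMod m) ∈ suppS m (topS m (dI m I)) w ↔ (rep2 m w).coeff k ≠ 0 := by
        intro w
        rw [suppS, Finset.mem_filter, topS, Finset.mem_filter, crd, ZMod.val_cast_of_lt hkm]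
        constructor
        · exact fun h => h.2
        · exact fun h => ⟨⟨Finset.mem_univ _, by omega⟩, h⟩
      apply zmod2_eq
      rw [← hmem, ← hmem, huv]
    · have : ∀ w : R2 m, (rep2 m w).coeff k = 0 := fun w => coeff_eq_zero_of_degree_lt
        (lt_of_lt_of_le (rep2_degree m w) (by exact_mod_cast not_lt.1 hkm))
      rw [this, this]
  rw [← mk2_rep2 m u, ← mk2_rep2 m v, sub_eq_zero.1 hsub]

open Classical in
/-- Elements of an ideal as a finset. -/
def elts (m : ℕ) [NeZero m] (I : Ideal (R2 m)) : Finset (R2 m) := Finset.univ.filter (fun u => u ∈ I)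

lemma mem_elts (m : ℕ) [NeZero m] (I : Ideal (R2 m)) (u : R2 m) : u ∈ elts m I ↔ u ∈ I := by
  simp [elts]

lemma card_elts (m : ℕ) [NeZero m] (I : Ideal (R2 m)) : (elts m I).card = 2 ^ dI m I := by
  rw [← card_dI]
  have : (elts m I : Set (R2 m)) = (I : Set (R2 m)) := by
    ext u; simp [mem_elts]
  rw [← Set.ncard_coe_finset, this]
  rfl

lemma sum_supp_le (m : ℕ) [NeZero m] (I : Ideal (R2 m)) (μ : ℝ) (hμ : 0 < μ) :
    ∑ u ∈ elts m I, μ ^ (suppS m (topS m (dI m I)) u).card ≤ (1 + μ) ^ dI m I := by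
  classical
  have h1 := Finset.sum_pow_mul_eq_add_pow μ 1 (topS m (dI m I))
  simp only [one_pow, mul_one] at h1
  rw [topS_card m _ (dI_le m I)] at h1
  rw [add_comm 1 μ, ← h1]
  rw [← Finset.sum_image (f := fun t : Finset (ZMod m) => μ ^ t.card)
    (g := suppS m (topS m (dI m I))) (s := elts m I)]
  · refine Finset.sum_le_sum_of_subset_of_nonneg ?_ (fun _ _ _ => by positivity)
    intro t ht
    obtain ⟨u, _, rfl⟩ := Finset.mem_image.1 ht
    exact Finset.mem_powerset.2 (Finset.filter_subset _ _)
  · intro u hu v hv h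
    exact supp_inj m I ((mem_elts _ _ _).1 hu) ((mem_elts _ _ _).1 hv) h

lemma avg_supp (m : ℕ) [NeZero m] (hm : 1 < m) (S : Finset (ZMod m)) (u : R2 m) :
    ∑ i : ZMod m, (suppS m S (mk2 m X ^ i.val * u)).card = S.card * wt2 m u := by
  have h1 : ∀ i : ZMod m, (suppS m S (mk2 m X ^ i.val * u)).card
      = ∑ j ∈ S, if crd m u (j - i) ≠ 0 then 1 else 0 := by
    intro i
    rw [suppS, Finset.card_filter]
    refine Finset.sum_congr rfl (fun j _ => ?_)
    rw [crd_shift_pow m hm]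
    simp
  simp_rw [h1]
  rw [Finset.sum_comm, wt2_eq, Finset.card_filter, ← smul_eq_mul, ← Finset.sum_const]
  refine Finset.sum_congr rfl (fun j _ => ?_)
  exact Equiv.sum_comp (Equiv.subLeft j) (fun k => if crd m u k ≠ 0 then 1 else 0)

lemma weight_sum (m : ℕ) [NeZero m] (hm : 1 < m) (I : Ideal (R2 m)) (μ : ℝ) (hμ : 0 < μ) :
    ∑ u ∈ elts m I, μ ^ ((dI m I : ℝ) / m * wt2 m u) ≤ (1 + μ) ^ dI m I := by
  have hm0 : (0:ℝ) < m := by exact_mod_cast (by omega : 0 < m)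
  set S := topS m (dI m I)
  have hconv : ∀ u : R2 m, μ ^ ((dI m I : ℝ) / m * wt2 m u) ≤
      ∑ i : ZMod m, (1 / m : ℝ) * μ ^ (suppS m S (mk2 m X ^ i.val * u)).card := by
    intro u
    have h := (convexOn_rpow_left hμ).map_sum_le (t := Finset.univ)
      (w := fun _ : ZMod m => (1 / m : ℝ))
      (p := fun i => ((suppS m S (mk2 m X ^ i.val * u)).card : ℝ))
      (fun _ _ => by positivity) (by simp [ZMod.card, hm0.ne']) (fun _ _ => Set.mem_univ _)
    simp only [smul_eq_mul, Real.rpow_natCast] at h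
    refine le_trans (le_of_eq ?_) h
    congr 1
    rw [← Finset.mul_sum, ← Nat.cast_sum, avg_supp m hm, topS_card m _ (dI_le m I)]
    push_cast; ring
  refine (Finset.sum_le_sum (fun u _ => hconv u)).trans ?_
  rw [Finset.sum_comm]
  have hi : ∀ i : ZMod m, ∑ u ∈ elts m I, (1 / m : ℝ) * μ ^ (suppS m S (mk2 m X ^ i.val * u)).card
      ≤ (1 / m : ℝ) * (1 + μ) ^ dI m I := by
    intro i
    rw [← Finset.mul_sum]
    refine mul_le_mul_of_nonneg_left ?_ (by positivity)
    refine le_trans ?_ (sum_supp_le m I μ hμ)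
    classical
    rw [← Finset.sum_image (f := fun u : R2 m => μ ^ (suppS m S u).card)
      (g := fun u => mk2 m X ^ i.val * u) (s := elts m I) ((shift_inj m i.val).injOn)]
    refine Finset.sum_le_sum_of_subset_of_nonneg ?_ (fun _ _ _ => by positivity)
    intro v hv
    obtain ⟨u, hu, rfl⟩ := Finset.mem_image.1 hv
    rw [mem_elts] at hu ⊢
    exact I.mul_mem_left _ hu
  refine (Finset.sum_le_sum (fun i _ => hi i)).trans ?_
  simp [ZMod.card, hm0.ne']

lemma mem_J (m : ℕ) (p : Polynomial (ZMod 2)) : mk2 m p ∈ Jm m ↔ (X - 1) ∣ p := by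
  rw [Jm, Ideal.mem_span_singleton']
  constructor
  · rintro ⟨a, ha⟩
    obtain ⟨c, rfl⟩ := mk2_surj m a
    rw [← map_mul, mk2_eq_iff] at ha
    have h1 : (X - 1) ∣ fm m := ⟨geomPoly m, by rw [mul_comm, geom_mul]⟩
    have h2 := h1.trans ha
    exact (dvd_sub_right (Dvd.intro_left c rfl)).1 h2
  · rintro ⟨c, rfl⟩
    exact ⟨mk2 m c, by rw [← map_mul, mul_comm]⟩

lemma X1_ne : (X - 1 : Polynomial (ZMod 2)) ≠ 0 := by
  simpa using X_sub_C_ne_zero (1 : ZMod 2)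

lemma monic2 (p : Polynomial (ZMod 2)) (hp : p ≠ 0) : p.Monic := by
  have h : p.leadingCoeff ≠ 0 := leadingCoeff_ne_zero.2 hp
  have : ∀ a : ZMod 2, a ≠ 0 → a = 1 := by decide
  exact this _ h

lemma dI_J (m : ℕ) [NeZero m] : dI m (Jm m) = m - 1 := by
  obtain ⟨g, h, h1, h2, h3⟩ := ideal_struct' m (Jm m)
  have hfne := (fm_monic m).ne_zero
  have hg0 : g ≠ 0 := by rintro rfl; exact hfne (by rw [← h1, zero_mul])
  have hh0 : h ≠ 0 := by rintro rfl; exact hfne (by rw [← h1, mul_zero])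
  have hdeg : m = g.natDegree + h.natDegree := by
    rw [← natDegree_mul hg0 hh0, h1, fm_natDegree]
  have h4 : g ∣ (X - 1) := by rw [← h2, mem_J]
  have h5 : (X - 1) ∣ g := by rw [← mem_J, h2]
  have h6 : g = X - 1 := eq_of_monic_of_associated (monic2 g hg0) (monic2 _ X1_ne)
    (associated_of_dvd_dvd h4 h5)
  have h7 : g.natDegree = 1 := by rw [h6]; simpa using natDegree_X_sub_C (1 : ZMod 2)
  omega

open Classical in
/-- Nonzero ideals inside `J`. -/
def idls (m : ℕ) [NeZero m] : Finset (Ideal (R2 m)) :=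
  Finset.univ.filter (fun I => I ≤ Jm m ∧ I ≠ ⊥)

lemma geom_ne (m : ℕ) [NeZero m] : geomPoly m ≠ 0 := by
  intro h
  have := geom_mul m
  rw [h, zero_mul] at this
  exact (fm_monic m).ne_zero this.symm

lemma ideal_sum (m : ℕ) [NeZero m] (hodd : Odd m) (x y : ℝ) (hx : 0 < x) (hy : 0 ≤ y)
    (hxy : ∀ p : Polynomial (ZMod 2), Irreducible p → p ∣ geomPoly m → x ^ p.natDegree ≤ y) :
    ∑ I ∈ idls m, x ^ dI m I ≤ (1 + y) ^ m - 1 := by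
  classical
  have hfne := (fm_monic m).ne_zero
  choose g h h1 h2 h3 using ideal_struct' m
  have hg0 : ∀ I, g I ≠ 0 := by intro I hI; exact hfne (by rw [← h1 I, hI, zero_mul])
  have hh0 : ∀ I, h I ≠ 0 := by intro I hI; exact hfne (by rw [← h1 I, hI, mul_zero])
  have hsqf : Squarefree (fm m) := by
    apply Separable.squarefree
    rw [fm, X_pow_sub_one_separable_iff]
    intro h0
    rw [ZMod.natCast_eq_zero_iff] at h0
    exact (Nat.not_even_iff_odd.2 hodd) (even_iff_two_dvd.2 h0)
  have hsqd : ∀ q, q ∣ fm m → (UniqueFactorizationMonoid.normalizedFactors q).Nodup := by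
    intro q hq
    have hq' := hsqf.squarefree_of_dvd hq
    exact (UniqueFactorizationMonoid.squarefree_iff_nodup_normalizedFactors hq'.ne_zero).1 hq'
  let T : Polynomial (ZMod 2) → Finset (Polynomial (ZMod 2)) := fun q =>
    (UniqueFactorizationMonoid.normalizedFactors q).toFinset
  have hT : ∀ q, q ∣ fm m → q ≠ 0 → ∏ p ∈ T q, p = q := by
    intro q hq hq0
    have e1 : ∏ p ∈ T q, p = (UniqueFactorizationMonoid.normalizedFactors q).prod := by
      simp only [T]
      rw [Finset.prod, Multiset.toFinset_val, Multiset.dedup_eq_self.2 (hsqd q hq), Multiset.map_id']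
    rw [e1, UniqueFactorizationMonoid.prod_normalizedFactors_eq hq0, (monic2 q hq0).normalize_eq_self]
  have hTmem : ∀ q, ∀ p ∈ T q, Irreducible p ∧ p ∣ q := by
    intro q p hp
    have hp' := Multiset.mem_toFinset.1 hp
    exact ⟨UniqueFactorizationMonoid.irreducible_of_normalized_factor p hp',
      UniqueFactorizationMonoid.dvd_of_mem_normalizedFactors hp'⟩
  have hgf : geomPoly m ∣ fm m := ⟨X - 1, (geom_mul m).symm⟩
  have hhg : ∀ I ∈ idls m, h I ∣ geomPoly m := by
    intro I hI
    have hIJ := (Finset.mem_filter.1 hI).2.1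
    have hgJ : (X - 1) ∣ g I := by
      rw [← mem_J]
      exact hIJ ((h2 I _).2 dvd_rfl)
    obtain ⟨g', hg'⟩ := hgJ
    have := h1 I
    rw [hg', ← geom_mul, mul_comm (geomPoly m), mul_assoc] at this
    exact Dvd.intro_left g' (mul_left_cancel₀ X1_ne this)
  have hhf : ∀ I ∈ idls m, h I ∣ fm m := fun I hI => (hhg I hI).trans hgf
  set P := T (geomPoly m) with hP
  have hPcard : P.card ≤ m := by
    have e1 := hT (geomPoly m) hgf (geom_ne m)
    have e2 : (geomPoly m).natDegree ≤ m := by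
      have := natDegree_le_of_dvd hgf hfne
      rwa [fm_natDegree] at this
    rw [← e1, natDegree_prod _ _ (fun p hp => (hTmem _ p hp).1.ne_zero)] at e2
    refine le_trans ?_ e2
    rw [Finset.card_eq_sum_ones]
    exact Finset.sum_le_sum (fun p hp => (hTmem _ p hp).1.natDegree_pos)
  have hinj : Set.InjOn (fun I => T (h I)) (idls m : Set (Ideal (R2 m))) := by
    intro I hI K hK hIK
    have e1 : h I = h K := by
      rw [← hT (h I) (hhf I hI) (hh0 I), ← hT (h K) (hhf K hK) (hh0 K)]
      simp only at hIK
      rw [hIK]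
    have e2 : g I = g K := by
      have := (h1 I).trans (h1 K).symm
      rw [e1] at this
      exact mul_right_cancel₀ (hh0 K) this
    ext u
    obtain ⟨p, rfl⟩ := mk2_surj m u
    rw [h2, h2, e2]
  have hterm : ∀ I ∈ idls m, x ^ dI m I ≤ y ^ (T (h I)).card := by
    intro I hI
    rw [h3 I]
    conv_lhs => rw [← hT (h I) (hhf I hI) (hh0 I)]
    rw [natDegree_prod _ _ (fun p hp => (hTmem _ p hp).1.ne_zero), ← Finset.prod_pow_eq_pow_sum,
      ← Finset.prod_const]
    refine Finset.prod_le_prod (fun p _ => by positivity) (fun p hp => ?_)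
    exact hxy p (hTmem _ p hp).1 ((hTmem _ p hp).2.trans (hhg I hI))
  have hsub : (idls m).image (fun I => T (h I)) ⊆ P.powerset.erase ∅ := by
    intro t ht
    obtain ⟨I, hI, rfl⟩ := Finset.mem_image.1 ht
    rw [Finset.mem_erase, Finset.mem_powerset]
    constructor
    · intro h0
      have e1 := hT (h I) (hhf I hI) (hh0 I)
      rw [h0, Finset.prod_empty] at e1
      apply (Finset.mem_filter.1 hI).2.2
      rw [eq_bot_iff]
      intro u hu
      obtain ⟨p, rfl⟩ := mk2_surj m u
      rw [h2] at hu
      have e2 := h1 I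
      rw [← e1, mul_one] at e2
      rw [e2] at hu
      rw [Ideal.mem_bot, ← map_zero (mk2 m), mk2_eq_iff]
      simpa using hu
    · intro p hp
      exact Multiset.mem_toFinset.2 (Multiset.mem_of_le
        ((UniqueFactorizationMonoid.dvd_iff_normalizedFactors_le_normalizedFactors (hh0 I)
          (geom_ne m)).1 (hhg I hI)) (Multiset.mem_toFinset.1 hp))
  calc ∑ I ∈ idls m, x ^ dI m I ≤ ∑ I ∈ idls m, y ^ (T (h I)).card := Finset.sum_le_sum hterm
    _ = ∑ t ∈ (idls m).image (fun I => T (h I)), y ^ t.card := by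
        rw [Finset.sum_image hinj]
    _ ≤ ∑ t ∈ P.powerset.erase ∅, y ^ t.card :=
        Finset.sum_le_sum_of_subset_of_nonneg hsub (fun _ _ _ => by positivity)
    _ = (1 + y) ^ P.card - 1 := by
        have e1 := Finset.sum_pow_mul_eq_add_pow y 1 P
        simp only [one_pow, mul_one] at e1
        rw [add_comm 1 y, ← e1, ← Finset.sum_erase_add _ _ (Finset.empty_mem_powerset P)]
        simp
    _ ≤ (1 + y) ^ m - 1 := by
        have := pow_le_pow_right₀ (by linarith : 1 ≤ 1 + y) hPcard
        linarith

lemma fiber_sum (m : ℕ) [NeZero m] (u : R2 m) (φ : R2 m → ℝ) :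
    (2 : ℝ) ^ dI m (Ideal.span {u}) * ∑ b : R2 m, φ (u * b)
      = (Fintype.card (R2 m) : ℝ) * ∑ v ∈ elts m (Ideal.span {u}), φ v := by
  classical
  set I := Ideal.span {u}
  have hmap : ∀ b ∈ (Finset.univ : Finset (R2 m)), u * b ∈ elts m I := by
    intro b _
    rw [mem_elts]
    exact Ideal.mul_mem_right _ _ (Ideal.mem_span_singleton_self u)
  set K := (Finset.univ.filter (fun b : R2 m => u * b = 0)).card
  have hfib : ∀ v ∈ elts m I, (Finset.univ.filter (fun b : R2 m => u * b = v)).card = K := by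
    intro v hv
    rw [mem_elts, Ideal.mem_span_singleton] at hv
    obtain ⟨c, rfl⟩ := hv
    refine Finset.card_bij' (fun b _ => b - c) (fun b _ => b + c) ?_ ?_ ?_ ?_
    · intro b hb
      simp only [Finset.mem_filter, Finset.mem_univ, true_and] at hb ⊢
      rw [mul_sub, hb, sub_self]
    · intro b hb
      simp only [Finset.mem_filter, Finset.mem_univ, true_and] at hb ⊢
      rw [mul_add, hb, zero_add]
    · intro b _; simp
    · intro b _; simp
  have hsum : ∑ b : R2 m, φ (u * b) = K * ∑ v ∈ elts m I, φ v := by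
    rw [← Finset.sum_fiberwise_of_maps_to hmap, Finset.mul_sum]
    refine Finset.sum_congr rfl (fun v hv => ?_)
    rw [Finset.sum_congr rfl (g := fun _ => φ v)
      (fun b hb => by rw [(Finset.mem_filter.1 hb).2]), Finset.sum_const, hfib v hv, nsmul_eq_mul]
  have hcard : Fintype.card (R2 m) = 2 ^ dI m I * K := by
    rw [← card_elts, ← Finset.card_univ, Finset.card_eq_sum_card_fiberwise hmap,
      Finset.sum_congr rfl hfib, Finset.sum_const, smul_eq_mul]
  rw [hsum, hcard]
  push_cast; ring

lemma code_exists (m : ℕ) [NeZero m] (hm : 1 < m) (μ ω : ℝ) (hμ : 0 < μ) (hμ1 : μ < 1)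
    (hsum : ∑ I ∈ idls m, ((1 + μ) ^ 2 * μ ^ (-(2 * ω)) / 2) ^ dI m I < 1) :
    ∃ b : R2 m, ∀ u ∈ Jm m, u ≠ 0 → 2 * m * ω < (wt2 m u + wt2 m (u * b) : ℝ) := by
  classical
  by_contra! hbad
  have hm0 : (0:ℝ) < m := by exact_mod_cast (by omega : 0 < m)
  set N : ℝ := (Fintype.card (R2 m) : ℝ) with hN
  have hNpos : 0 < N := by
    have : 0 < Fintype.card (R2 m) := Fintype.card_pos_iff.2 ⟨0⟩
    rw [hN]
    exact_mod_cast this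
  let d : R2 m → ℕ := fun u => dI m (Ideal.span {u})
  let F : R2 m → R2 m → ℝ := fun u b =>
    (μ ^ (-(2 * ω))) ^ d u * μ ^ ((d u : ℝ) / m * wt2 m u) * μ ^ ((d u : ℝ) / m * wt2 m (u * b))
  let J0 : Finset (R2 m) := (elts m (Jm m)).filter (fun u => u ≠ 0)
  have hFpos : ∀ u b, 0 ≤ F u b := fun u b => by positivity
  have h1 : ∀ b : R2 m, 1 ≤ ∑ u ∈ J0, F u b := by
    intro b
    obtain ⟨u, huJ, hu0, hle⟩ := hbad b
    have hu : u ∈ J0 := by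
      rw [Finset.mem_filter, mem_elts]; exact ⟨huJ, hu0⟩
    refine le_trans ?_ (Finset.single_le_sum (fun u _ => hFpos u b) hu)
    have : F u b = μ ^ ((d u : ℝ) / m * ((wt2 m u + wt2 m (u * b)) - 2 * m * ω)) := by
      simp only [F]
      rw [← Real.rpow_natCast, ← Real.rpow_mul hμ.le, ← Real.rpow_add hμ, ← Real.rpow_add hμ]
      congr 1
      field_simp
      ring
    rw [this]
    apply Real.one_le_rpow_of_pos_of_le_one_of_nonpos hμ hμ1.le
    apply mul_nonpos_of_nonneg_of_nonpos (by positivity)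
    linarith
  have h2 : N ≤ ∑ u ∈ J0, ∑ b : R2 m, F u b := by
    rw [Finset.sum_comm]
    calc N = ∑ b : R2 m, (1:ℝ) := by simp [hN]
      _ ≤ _ := Finset.sum_le_sum (fun b _ => h1 b)
  have h3 : ∀ u, ∑ b : R2 m, F u b ≤
      N * (((1 + μ) * μ ^ (-(2 * ω)) / 2) ^ d u * μ ^ ((d u : ℝ) / m * wt2 m u)) := by
    intro u
    have e1 := fiber_sum m u (fun v => μ ^ ((d u : ℝ) / m * wt2 m v))
    have e2 := weight_sum m hm (Ideal.span {u}) μ hμ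
    have e3 : ∑ b : R2 m, μ ^ ((d u : ℝ) / m * wt2 m (u * b)) ≤ N * (1 + μ) ^ d u / 2 ^ d u := by
      rw [le_div_iff₀ (by positivity), mul_comm]
      rw [e1]
      exact mul_le_mul_of_nonneg_left e2 hNpos.le
    simp only [F]
    rw [← Finset.mul_sum]
    calc _ ≤ (μ ^ (-(2 * ω))) ^ d u * μ ^ ((d u : ℝ) / m * wt2 m u) *
              (N * (1 + μ) ^ d u / 2 ^ d u) := mul_le_mul_of_nonneg_left e3 (by positivity)
      _ = _ := by rw [div_pow, mul_pow]; ring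
  have hmaps : ∀ u ∈ J0, Ideal.span {u} ∈ idls m := by
    intro u hu
    rw [Finset.mem_filter, mem_elts] at hu
    rw [idls, Finset.mem_filter]
    refine ⟨Finset.mem_univ _, ?_, ?_⟩
    · rw [Ideal.span_singleton_le_iff_mem]; exact hu.1
    · rw [Ne, Ideal.span_singleton_eq_bot]; exact hu.2
  have h4 : ∑ u ∈ J0, ∑ b : R2 m, F u b ≤
      N * ∑ I ∈ idls m, ((1 + μ) ^ 2 * μ ^ (-(2 * ω)) / 2) ^ dI m I := by
    refine (Finset.sum_le_sum (fun u _ => h3 u)).trans ?_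
    rw [← Finset.mul_sum]
    refine mul_le_mul_of_nonneg_left ?_ hNpos.le
    rw [← Finset.sum_fiberwise_of_maps_to hmaps]
    refine Finset.sum_le_sum (fun I _ => ?_)
    have e1 : ∀ u ∈ J0.filter (fun u => Ideal.span {u} = I),
        ((1 + μ) * μ ^ (-(2 * ω)) / 2) ^ d u * μ ^ ((d u : ℝ) / m * wt2 m u) =
        ((1 + μ) * μ ^ (-(2 * ω)) / 2) ^ dI m I * μ ^ ((dI m I : ℝ) / m * wt2 m u) := by
      intro u hu
      have : d u = dI m I := by simp only [d]; rw [(Finset.mem_filter.1 hu).2]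
      rw [this]
    rw [Finset.sum_congr rfl e1, ← Finset.mul_sum]
    have e2 : ∑ u ∈ J0.filter (fun u => Ideal.span {u} = I), μ ^ ((dI m I : ℝ) / m * wt2 m u)
        ≤ (1 + μ) ^ dI m I := by
      refine le_trans (Finset.sum_le_sum_of_subset_of_nonneg ?_ (fun _ _ _ => by positivity))
        (weight_sum m hm I μ hμ)
      intro u hu
      rw [mem_elts, ← (Finset.mem_filter.1 hu).2]
      exact Ideal.mem_span_singleton_self u
    calc _ ≤ ((1 + μ) * μ ^ (-(2 * ω)) / 2) ^ dI m I * (1 + μ) ^ dI m I :=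
          mul_le_mul_of_nonneg_left e2 (by positivity)
      _ = _ := by rw [← mul_pow]; ring
  have h5 := h2.trans h4
  have h6 : N * ∑ I ∈ idls m, ((1 + μ) ^ 2 * μ ^ (-(2 * ω)) / 2) ^ dI m I < N * 1 :=
    mul_lt_mul_of_pos_left hsum hNpos
  linarith

lemma entropy_lt (ω : ℝ) (h0 : 0 < ω) (h1 : ω < 1 / 2) (hH : Hent ω < 1 / 2) :
    (1 + ω / (1 - ω)) ^ 2 * (ω / (1 - ω)) ^ (-(2 * ω)) / 2 < 1 := by
  have hw : 0 < 1 - ω := by linarith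
  have hmu : 0 < ω / (1 - ω) := by positivity
  have e1 : 1 + ω / (1 - ω) = (1 - ω)⁻¹ := by field_simp; ring
  have hpos : 0 < (1 + ω / (1 - ω)) ^ 2 * (ω / (1 - ω)) ^ (-(2 * ω)) := by positivity
  rw [div_lt_one (by norm_num), ← Real.log_lt_log_iff hpos (by norm_num),
    Real.log_mul (by positivity) (by positivity), e1, Real.log_pow, Real.log_inv,
    Real.log_rpow hmu, Real.log_div h0.ne' hw.ne']
  have hl2 : 0 < Real.log 2 := Real.log_pos (by norm_num)
  unfold Hent Real.logb at hH
  have e2 : (-(ω * (Real.log ω / Real.log 2)) - (1 - ω) * (Real.log (1 - ω) / Real.log 2)) * Real.log 2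
      = -(ω * Real.log ω) - (1 - ω) * Real.log (1 - ω) := by
    field_simp
  have e3 := mul_lt_mul_of_pos_right hH hl2
  rw [e2] at e3
  push_cast
  nlinarith

/-- The idempotent generator of `J`. -/
def idem (m : ℕ) : R2 m := mk2 m (1 - geomPoly m)

lemma idem_mem (m : ℕ) (hodd : Odd m) : idem m ∈ Jm m := by
  rw [idem, mem_J]
  have : (X - C 1 : Polynomial (ZMod 2)) ∣ 1 - geomPoly m := by
    rw [dvd_iff_isRoot, IsRoot, eval_sub, geom_eval, eval_one]
    have : (m : ZMod 2) = 1 := by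
      obtain ⟨k, rfl⟩ := hodd
      push_cast
      rw [show (2 : ZMod 2) = 0 from rfl]; ring
    rw [this, sub_self]
  simpa using this

lemma idem_mul (m : ℕ) (u : R2 m) (hu : u ∈ Jm m) : u * idem m = u := by
  obtain ⟨p, rfl⟩ := mk2_surj m u
  rw [mem_J] at hu
  obtain ⟨c, rfl⟩ := hu
  rw [idem, ← map_mul, mk2_eq_iff, ← geom_mul]
  exact ⟨-c, by ring⟩

lemma dim_eq (m : ℕ) [NeZero m] (hodd : Odd m) (b : R2 m) :
    dimCab m (idem m) (idem m * b) = m - 1 := by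
  have : Cab m (idem m) (idem m * b) = (fun u => (u, iota m (u * b))) '' (Jm m : Set (R2 m)) := by
    ext w
    constructor
    · rintro ⟨f, rfl⟩
      exact ⟨f * idem m, Ideal.mul_mem_left _ _ (idem_mem m hodd), by simp only [mul_assoc]⟩
    · rintro ⟨u, hu, rfl⟩
      refine ⟨u, ?_⟩
      rw [← mul_assoc, idem_mul m u hu]
  rw [dimCab, this, Nat.card_image_of_injective (fun u v h => (Prod.ext_iff.1 h).1)]
  exact dI_J m

lemma good_code (δ : ℝ) (hδ0 : 0 < δ) (hδ1 : δ < 1/3) (hδ2 : Hent (3*δ/2) < 1/2) :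
    ∃ K : ℕ, 2 < K ∧ ∀ m, K ≤ m → GoodP m → Odd m ∧ ∃ b : R2 m,
      ∀ u ∈ Jm m, u ≠ 0 → 3 * m * δ < (wt2 m u + wt2 m (u * b) : ℝ) := by
  set ω := 3 * δ / 2 with hω
  have hω0 : 0 < ω := by positivity
  have hω1 : ω < 1 / 2 := by rw [hω]; linarith
  set μ := ω / (1 - ω) with hμ
  have hμ0 : 0 < μ := div_pos hω0 (by linarith)
  have hμ1 : μ < 1 := by rw [hμ, div_lt_one (by linarith)]; linarith
  set x := (1 + μ) ^ 2 * μ ^ (-(2 * ω)) / 2 with hx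
  have hx0 : 0 < x := by positivity
  have hx1 : x < 1 := entropy_lt ω hω0 hω1 hδ2
  have ht := tendsto_pow_const_mul_const_pow_of_abs_lt_one 4 (r := x)
    (by rw [abs_of_pos hx0]; exact hx1)
  obtain ⟨k0, hk0⟩ := Filter.eventually_atTop.1 (ht.eventually (gt_mem_nhds (by norm_num : (0:ℝ) < 1 / 2)))
  refine ⟨k0 ^ 4 + 3, by omega, ?_⟩
  intro m hm hgood
  have hm2 : 2 < m := by omega
  have hodd : Odd m := hgood.1.odd_of_ne_two (by omega)
  have : NeZero m := ⟨by omega⟩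
  refine ⟨hodd, ?_⟩
  have hm0 : (0:ℝ) < m := by exact_mod_cast (by omega : 0 < m)
  have hsum := ideal_sum m hodd x (1 / (2 * m)) hx0 (by positivity) (by
    intro p hp hpd
    have e1 := irr_deg m hgood hodd p hp hpd
    have e2 : k0 ≤ p.natDegree := by
      have : k0 ^ 4 < p.natDegree ^ 4 := by omega
      exact (lt_of_pow_lt_pow_left₀ 4 (by omega) this).le
    have e3 := hk0 _ e2
    have e4 : (m : ℝ) ≤ (p.natDegree : ℝ) ^ 4 := by exact_mod_cast e1.le
    have e5 : (m : ℝ) * x ^ p.natDegree ≤ (p.natDegree : ℝ) ^ 4 * x ^ p.natDegree := by gcongr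
    rw [le_div_iff₀ (by positivity)]
    linarith)
  have hlt : (1 + 1 / (2 * m) : ℝ) ^ m - 1 < 1 := by
    have e1 : (1 + 1 / (2 * m) : ℝ) ≤ Real.exp (1 / (2 * m)) := by
      rw [add_comm]; exact Real.add_one_le_exp _
    have e2 : (1 + 1 / (2 * m) : ℝ) ^ m ≤ Real.exp (1 / 2) := by
      calc _ ≤ Real.exp (1 / (2 * m)) ^ m := by gcongr
        _ = Real.exp (1 / 2) := by rw [← Real.exp_nat_mul]; congr 1; field_simp
    have e3 : Real.exp (1 / 2) < 2 := by
      rw [← Real.lt_log_iff_exp_lt (by norm_num)]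
      linarith [Real.log_two_gt_d9]
    linarith
  obtain ⟨b, hb⟩ := code_exists m (by omega) μ ω hμ0 hμ1 (lt_of_le_of_lt hsum hlt)
  refine ⟨b, fun u hu hu0 => ?_⟩
  have := hb u hu hu0
  have e : 3 * (m:ℝ) * δ = 2 * m * ω := by rw [hω]; ring
  rw [e]; exact this

open Filter Topology in
/-- For `0 < δ < 1/3` with `H(3δ/2) < 1/2` there is a sequence of odd
positive integers `m_1 < m_2 < ⋯` and codes `C_i = C_{a_i,b_i}` (with `a_i, b_i ∈ J_{m_i}`)
whose rates `dim C_i/(3m_i)` tend to `1/3` and whose relative minimal distances satisfy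
`Δ(C_i) > δ`: in particular, Z2Z4-additive cyclic codes are asymptotically good. -/
theorem statement12 (δ : ℝ) (hδ0 : 0 < δ) (hδ1 : δ < 1/3) (hδ2 : Hent (3*δ/2) < 1/2) :
    ∃ ms : ℕ → ℕ, StrictMono ms ∧ (∀ i, Odd (ms i)) ∧ (∀ i, 0 < ms i) ∧
      Tendsto (fun i => (ms i : ℝ)) atTop atTop ∧
      ∃ a : (i : ℕ) → R2 (ms i), ∃ b : (i : ℕ) → R2 (ms i),
        (∀ i, a i ∈ Jm (ms i)) ∧ (∀ i, b i ∈ Jm (ms i)) ∧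
        Tendsto (fun i => (dimCab (ms i) (a i) (b i) : ℝ) / (3 * (ms i : ℝ)))
          atTop (nhds (1/3)) ∧
        ∀ i, ∀ c : R2 (ms i),
          (c * a i, iota (ms i) (c * b i)) ≠ (0 : R2 (ms i) × R4 (ms i)) →
          3 * (ms i : ℝ) * δ
            < ((wt2 (ms i) (c * a i) + 2 * wt2 (ms i) (c * b i) : ℕ) : ℝ) := by
  obtain ⟨K, hK2, hK⟩ := good_code δ hδ0 hδ1 hδ2
  have hinf : {q | K ≤ q ∧ GoodP q}.Infinite := by
    have := good_infinite.sdiff (Set.finite_lt_nat K)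
    refine this.mono ?_
    rintro q ⟨h1, h2⟩
    exact ⟨not_lt.1 h2, h1⟩
  let ms : ℕ → ℕ := Nat.nth (fun q => K ≤ q ∧ GoodP q)
  have hmem : ∀ i, K ≤ ms i ∧ GoodP (ms i) := fun i => Nat.nth_mem_of_infinite hinf i
  have hmono : StrictMono ms := Nat.nth_strictMono hinf
  have hodd : ∀ i, Odd (ms i) := fun i => (hK _ (hmem i).1 (hmem i).2).1
  have hpos : ∀ i, 0 < ms i := fun i => by have := (hmem i).1; omega
  have hne : ∀ i, NeZero (ms i) := fun i => ⟨(hpos i).ne'⟩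
  choose b hb using fun i => (hK _ (hmem i).1 (hmem i).2).2
  have htend : Tendsto (fun i => (ms i : ℝ)) atTop atTop :=
    tendsto_natCast_atTop_atTop.comp hmono.tendsto_atTop
  refine ⟨ms, hmono, hodd, hpos, htend, fun i => idem (ms i), fun i => idem (ms i) * b i,
    fun i => idem_mem _ (hodd i), fun i => Ideal.mul_mem_right _ _ (idem_mem _ (hodd i)), ?_, ?_⟩
  · have h1 : ∀ i, (dimCab (ms i) (idem (ms i)) (idem (ms i) * b i) : ℝ) / (3 * (ms i : ℝ))
        = 1 / 3 - (1 / 3) * (ms i : ℝ)⁻¹ := by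
      intro i
      have := hne i
      rw [dim_eq _ (hodd i), Nat.cast_sub (hpos i)]
      have : (ms i : ℝ) ≠ 0 := by exact_mod_cast (hpos i).ne'
      field_simp
      push_cast
      ring
    simp_rw [h1]
    simpa using (tendsto_const_nhds (x := (1 / 3 : ℝ))).sub
      ((tendsto_inv_atTop_zero.comp htend).const_mul (1 / 3 : ℝ))
  · intro i c hc
    have := hne i
    have hmul : c * (idem (ms i) * b i) = (c * idem (ms i)) * b i := by ring
    have hu0 : c * idem (ms i) ≠ 0 := by
      intro h0
      apply hc
      simp only [hmul, h0, zero_mul, iota_zero]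
      rfl
    have h1 := hb i (c * idem (ms i)) (Ideal.mul_mem_left _ _ (idem_mem _ (hodd i))) hu0
    refine lt_of_lt_of_le h1 ?_
    simp only [hmul]
    push_cast
    have : (0:ℝ) ≤ (wt2 (ms i) (c * idem (ms i) * b i) : ℝ) := Nat.cast_nonneg _
    linarith

end
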